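/- arXiv:1006.4290 — 2 statements merged into one kernel-verified Lean document; each statement's English description precedes it below -/
import Mathlib

section
/- Let B be a content R-algebra such that the content function of B is onto. Then R has Property (A) if and only if for every f ∈ B, f is a non-zero-divisor of B exactly when c(f) is a regular ideal of R, i.e. c(f) contains a non-zero-divisor of R. -/
/-- The content `c(f)` of an element `f` of a commutative `R`-algebra `B`: the
intersection of all ideals `I` of `R` with `f ∈ IB`. -/
def contentIdeal (R : Type*) {B : Type*} [CommRing R] [CommRing B] [Algebra R B]
    (f : B) : Ideal R :=
  sInf {I : Ideal R | f ∈ I • (⊤ : Submodule R B)}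

/-- `B` is a content `R`-algebra: (i) `f ∈ c(f)B` for all `f`; (ii) `c(rf) = r·c(f)`
and the ideal generated by all the contents is `R`; (iii) the Dedekind–Mertens content
formula holds. -/
structure IsContentAlgebra (R B : Type*) [CommRing R] [CommRing B] [Algebra R B] : Prop where
  mem_content_smul : ∀ f : B, f ∈ contentIdeal R f • (⊤ : Submodule R B)
  content_smul : ∀ (r : R) (f : B),
    contentIdeal R (algebraMap R B r * f) = Ideal.span {r} * contentIdeal R f
  content_top : (⨆ f : B, contentIdeal R f) = ⊤
  dedekind_mertens : ∀ f g : B, ∃ n : ℕ, 1 ≤ n ∧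
    contentIdeal R f ^ n * contentIdeal R g =
      contentIdeal R f ^ (n - 1) * contentIdeal R (f * g)

/-- The set of zero-divisors of `R`. -/
def zdSet (R : Type*) [CommRing R] : Set R := {r : R | ∃ s : R, s ≠ 0 ∧ r * s = 0}

/-- `R` has Property (A): every finitely generated ideal consisting of zero-divisors has
a nonzero annihilator. -/
def PropertyA (R : Type*) [CommRing R] : Prop :=
  ∀ I : Ideal R, I.FG → (I : Set R) ⊆ zdSet R → ∃ r : R, r ≠ 0 ∧ ∀ x ∈ I, r * x = 0

namespace IsContentAlgebra

variable {R B : Type*} [CommRing R] [CommRing B] [Algebra R B]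

theorem content_eq_bot_iff (hB : IsContentAlgebra R B) {f : B} :
    contentIdeal R f = ⊥ ↔ f = 0 := by
  refine ⟨fun h => ?_, ?_⟩
  · simpa [h] using hB.mem_content_smul f
  · rintro rfl
    exact le_bot_iff.mp (sInf_le (zero_mem ((⊥ : Ideal R) • (⊤ : Submodule R B))))

theorem content_fg (hB : IsContentAlgebra R B) (f : B) : (contentIdeal R f).FG := by
  obtain ⟨J, hJ, hJle, hfJ⟩ : ∃ J : Ideal R, J.FG ∧ J ≤ contentIdeal R f ∧
      f ∈ J • (⊤ : Submodule R B) := by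
    refine Submodule.smul_induction_on
      (p := fun x => ∃ J : Ideal R, J.FG ∧ J ≤ contentIdeal R f ∧ x ∈ J • (⊤ : Submodule R B))
      (hB.mem_content_smul f) (fun r hr b _ => ?_) ?_
    · exact ⟨Ideal.span {r}, Submodule.fg_span_singleton r,
        (Ideal.span_singleton_le_iff_mem _).mpr hr,
        Submodule.smul_mem_smul (Ideal.mem_span_singleton_self r) trivial⟩
    · rintro x y ⟨J, hJ, hJle, hx⟩ ⟨K, hK, hKle, hy⟩
      exact ⟨J ⊔ K, Submodule.FG.sup hJ hK, sup_le hJle hKle,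
        add_mem (Submodule.smul_mono_left le_sup_left hx)
          (Submodule.smul_mono_left le_sup_right hy)⟩
  have hle : contentIdeal R f ≤ J := sInf_le hfJ
  rwa [hle.antisymm hJle]

/-- One half of McCoy's theorem for content algebras. -/
theorem exists_annihilator_content_of_mem_zdSet (hB : IsContentAlgebra R B) {f : B}
    (hf : f ∈ zdSet B) : ∃ r : R, r ≠ 0 ∧ ∀ x ∈ contentIdeal R f, r * x = 0 := by
  classical
  obtain ⟨g, hg, hfg⟩ := hf
  have hex : ∃ n, contentIdeal R f ^ n * contentIdeal R g = ⊥ := by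
    obtain ⟨n, -, h⟩ := hB.dedekind_mertens f g
    exact ⟨n, by rw [h, hfg, hB.content_eq_bot_iff.mpr rfl, Ideal.mul_bot]⟩
  obtain ⟨m, hm⟩ : ∃ m, Nat.find hex = m + 1 := by
    refine Nat.exists_eq_succ_of_ne_zero fun h0 => hg (hB.content_eq_bot_iff.mp ?_)
    simpa [h0] using Nat.find_spec hex
  have hne : contentIdeal R f ^ m * contentIdeal R g ≠ ⊥ := Nat.find_min hex (by omega)
  obtain ⟨r, hr, hr0⟩ := Submodule.exists_mem_ne_zero_of_ne_bot hne
  refine ⟨r, hr0, fun x hx => ?_⟩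
  have hmem : x * r ∈ contentIdeal R f ^ (m + 1) * contentIdeal R g := by
    rw [pow_succ', mul_assoc]
    exact Ideal.mul_mem_mul hx hr
  rw [← hm, Nat.find_spec hex] at hmem
  rw [mul_comm]
  exact hmem

/-- The other half of McCoy's theorem, when some element has unit content. -/
theorem mem_zdSet_of_annihilator_content (hB : IsContentAlgebra R B) {f g : B}
    (hg : contentIdeal R g = ⊤) {r : R} (hr : r ≠ 0)
    (h : ∀ x ∈ contentIdeal R f, r * x = 0) : f ∈ zdSet B := by
  refine ⟨algebraMap R B r * g, fun h0 => hr ?_, ?_⟩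
  · have := hB.content_smul r g
    rw [h0, hB.content_eq_bot_iff.mpr rfl, hg, Ideal.mul_top] at this
    exact Ideal.span_singleton_eq_bot.mp this.symm
  · have hrf : algebraMap R B r * f = 0 := by
      rw [← hB.content_eq_bot_iff, hB.content_smul, eq_bot_iff, Ideal.span_singleton_mul_le_iff]
      exact h
    rw [mul_left_comm, ← mul_assoc, hrf, zero_mul]

end IsContentAlgebra

/-- Let `B` be a content `R`-algebra whose content function is onto (every finitely
generated ideal of `R` is the content of some element of `B`). Then `R` has Property (A)
iff for every `f ∈ B`, `f` is a non-zero-divisor of `B` exactly when `c(f)` is a regular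
ideal of `R` (i.e. contains a non-zero-divisor of `R`). -/
theorem propertyA_iff_regular_content
    (R B : Type*) [CommRing R] [CommRing B] [Algebra R B]
    (hB : IsContentAlgebra R B)
    (honto : ∀ I : Ideal R, I.FG → ∃ f : B, contentIdeal R f = I) :
    PropertyA R ↔ ∀ f : B, (f ∉ zdSet B ↔ ∃ r ∈ contentIdeal R f, r ∉ zdSet R) := by
  constructor
  · intro hA f
    refine ⟨fun hf => ?_, ?_⟩
    · by_contra! hzd
      obtain ⟨r, hr, h⟩ := hA _ (hB.content_fg f) hzd
      obtain ⟨g, hg⟩ := honto ⊤ ⟨{1}, by simp⟩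
      exact hf (hB.mem_zdSet_of_annihilator_content hg hr h)
    · rintro ⟨x, hx, hxr⟩ hf
      obtain ⟨r, hr, h⟩ := hB.exists_annihilator_content_of_mem_zdSet hf
      exact hxr ⟨r, hr, by rw [mul_comm, h x hx]⟩
  · intro H I hI hzd
    obtain ⟨f, rfl⟩ := honto I hI
    refine hB.exists_annihilator_content_of_mem_zdSet (by_contra fun hf => ?_)
    obtain ⟨x, hx, hxr⟩ := (H f).mp hf
    exact hxr (hzd hx)
end

section
/- Let B be a content R-algebra, I an ideal of R, and f ∈ B. Then f is not prime to IB — that is, (IB : f) ≠ IB — if and only if there exists r ∈ R with r ∉ I such that f·r ∈ IB. -/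
theorem mem_map_iff_mem_smul_top {R B : Type*} [CommRing R] [CommRing B] [Algebra R B]
    (I : Ideal R) (f : B) :
    f ∈ I.map (algebraMap R B) ↔ f ∈ I • (⊤ : Submodule R B) := by
  rw [Ideal.smul_top_eq_map, Submodule.restrictScalars_mem]

theorem IsContentAlgebra.mem_map_iff {R B : Type*} [CommRing R] [CommRing B] [Algebra R B]
    (hB : IsContentAlgebra R B) {I : Ideal R} {f : B} :
    f ∈ I.map (algebraMap R B) ↔ contentIdeal R f ≤ I := by
  rw [mem_map_iff_mem_smul_top]
  exact ⟨fun h => sInf_le h,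
    fun h => Submodule.smul_mono_left h (hB.mem_content_smul f)⟩

/-- The extension of ideals to a content algebra contracts back to the original ideal. -/
theorem IsContentAlgebra.algebraMap_mem_map_iff {R B : Type*} [CommRing R] [CommRing B]
    [Algebra R B] (hB : IsContentAlgebra R B) {I : Ideal R} {r : R} :
    algebraMap R B r ∈ I.map (algebraMap R B) ↔ r ∈ I := by
  refine ⟨fun h => ?_, fun h => Ideal.mem_map_of_mem _ h⟩
  have hle : Ideal.span {r} * ⨆ g : B, contentIdeal R g ≤ I := by
    rw [Ideal.mul_iSup]
    refine iSup_le fun g => ?_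
    rw [← hB.content_smul]
    exact hB.mem_map_iff.1 (Ideal.mul_mem_right g _ h)
  rw [hB.content_top, Ideal.mul_top] at hle
  exact hle (Ideal.mem_span_singleton_self r)

/-- If `J ^ n * K ≤ I` but `¬ K ≤ I`, some element outside `I` multiplies `J` into `I`. -/
theorem Ideal.exists_notMem_span_singleton_mul_le {R : Type*} [CommRing R] {I J K : Ideal R}
    (hK : ¬ K ≤ I) (n : ℕ) (h : J ^ n * K ≤ I) :
    ∃ r ∉ I, Ideal.span {r} * J ≤ I := by
  induction n with
  | zero => exact absurd (by simpa using h) hK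
  | succ n ih =>
    by_cases hn : J ^ n * K ≤ I
    · exact ih hn
    · obtain ⟨r, hr, hrI⟩ := SetLike.not_le_iff_exists.1 hn
      refine ⟨r, hrI, le_trans ?_ h⟩
      calc Ideal.span {r} * J ≤ (J ^ n * K) * J :=
            Ideal.mul_mono_left ((Ideal.span_singleton_le_iff_mem _).2 hr)
        _ = J ^ (n + 1) * K := by ring

theorem Ideal.mem_colon_span_singleton_iff {B : Type*} [CommRing B] {J : Ideal B} {f g : B} :
    g ∈ J.colon (Ideal.span {f}) ↔ g * f ∈ J := by
  rw [Submodule.mem_colon]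
  refine ⟨fun h => h f (Ideal.mem_span_singleton_self f), fun h p hp => ?_⟩
  obtain ⟨a, rfl⟩ := Ideal.mem_span_singleton'.1 hp
  rw [smul_eq_mul, mul_left_comm]
  exact J.mul_mem_left a h

/-- Let `B` be a content `R`-algebra, `I` an ideal of `R` and `f ∈ B`. Then `f` is not
prime to `IB` (that is, `(IB : f) ≠ IB`) iff `f·r ∈ IB` for some `r ∈ R` with `r ∉ I`. -/
theorem not_prime_to_extension_iff
    (R B : Type*) [CommRing R] [CommRing B] [Algebra R B]
    (hB : IsContentAlgebra R B) (I : Ideal R) (f : B) :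
    (I.map (algebraMap R B)).colon (Ideal.span {f}) ≠ I.map (algebraMap R B) ↔
      ∃ r : R, r ∉ I ∧ f * algebraMap R B r ∈ I.map (algebraMap R B) := by
  constructor
  · intro hne
    have hle : I.map (algebraMap R B) ≤ (I.map (algebraMap R B)).colon (Ideal.span {f}) :=
      fun g hg => Ideal.mem_colon_span_singleton_iff.2 (Ideal.mul_mem_right f _ hg)
    obtain ⟨g, hg, hgI⟩ := SetLike.not_le_iff_exists.1 fun h => hne (le_antisymm h hle)
    rw [Ideal.mem_colon_span_singleton_iff, mul_comm, hB.mem_map_iff] at hg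
    rw [hB.mem_map_iff] at hgI
    obtain ⟨n, -, hn⟩ := hB.dedekind_mertens f g
    obtain ⟨r, hr, hrf⟩ := Ideal.exists_notMem_span_singleton_mul_le hgI n
      (hn.trans_le (Ideal.mul_le_right.trans hg))
    refine ⟨r, hr, ?_⟩
    rwa [mul_comm, hB.mem_map_iff, hB.content_smul]
  · rintro ⟨r, hr, hrf⟩ heq
    refine hr (hB.algebraMap_mem_map_iff.1 ?_)
    rw [← heq, Ideal.mem_colon_span_singleton_iff, mul_comm]
    exact hrf
end
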